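/- Let G be a free group of finite rank and let Φ be an automorphism of G such that for every g ∈ G, the element Φ(g) is conjugate to g. Then Φ is an inner automorphism: there exists c ∈ G such that Φ(g) = c·g·c⁻¹ for every g ∈ G. -/

import Mathlib

namespace FreeGroup

variable {α : Type*}

theorem IsReduced.invRev {L : List (α × Bool)} (h : IsReduced L) :
    IsReduced (FreeGroup.invRev L) := by
  unfold IsReduced FreeGroup.invRev at *
  rw [List.isChain_reverse, List.isChain_map]
  exact h.imp fun a b hab h' => by simp [hab h'.symm]

theorem IsCyclicallyReduced.norm_mk_pow [DecidableEq α] {L : List (α × Bool)}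
    (h : IsCyclicallyReduced L) (n : ℕ) : norm (mk L ^ n) = n * L.length := by
  rw [pow_mk, norm, toWord_mk, (h.flatten_replicate n).isReduced.reduce_eq]
  simp

theorem IsCyclicallyReduced.length_le_of_isConj {L₁ L₂ : List (α × Bool)}
    (h₁ : IsCyclicallyReduced L₁) (h₂ : IsCyclicallyReduced L₂)
    (h : IsConj (mk L₁) (mk L₂)) : L₂.length ≤ L₁.length := by
  classical
  obtain ⟨c, hc⟩ := isConj_iff.1 h
  by_contra! hlt
  have key (n : ℕ) : n * L₂.length ≤ n * L₁.length + 2 * norm c := by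
    rw [← h₁.norm_mk_pow, ← h₂.norm_mk_pow, ← hc, conj_pow]
    have h1 := norm_mul_le (c * mk L₁ ^ n) c⁻¹
    have h2 := norm_mul_le c (mk L₁ ^ n)
    rw [norm_inv_eq] at h1
    omega
  have := key (2 * norm c + 1)
  nlinarith

/-- Stripping powers of a generator from the left of a word. -/
theorem exists_zpow_mul_mk_suffix (i : α) (L : List (α × Bool)) :
    ∃ (k : ℤ) (U : List (α × Bool)), U <:+ L ∧ (∀ a ∈ U.head?, a.1 ≠ i) ∧
      mk L = of i ^ k * mk U := by
  induction L with
  | nil => exact ⟨0, [], by simp⟩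
  | cons a L ih =>
    by_cases ha : a.1 = i
    · obtain ⟨k, U, hU, hhead, heq⟩ := ih
      have hcons : mk (a :: L) = mk [a] * mk L := by simp [mul_mk]
      obtain ⟨x, b⟩ := a
      obtain rfl : x = i := ha
      cases b
      · refine ⟨-1 + k, U, hU.trans (List.suffix_cons _ _), hhead, ?_⟩
        rw [hcons, heq, zpow_add, mul_assoc, zpow_neg_one]
        rfl
      · refine ⟨1 + k, U, hU.trans (List.suffix_cons _ _), hhead, ?_⟩
        rw [hcons, heq, zpow_add, mul_assoc, zpow_one]
        rfl
    · exact ⟨0, a :: L, List.suffix_rfl, by simpa using ha, by simp⟩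

/-- Stripping powers of a generator from the right of a word. -/
theorem exists_mk_prefix_mul_zpow (j : α) (L : List (α × Bool)) :
    ∃ (k : ℤ) (U : List (α × Bool)), U <+: L ∧ (∀ a ∈ U.getLast?, a.1 ≠ j) ∧
      mk L = mk U * of j ^ k := by
  obtain ⟨k, U, ⟨V, hV⟩, hhead, heq⟩ := exists_zpow_mul_mk_suffix j (invRev L)
  refine ⟨-k, invRev U, ⟨invRev V, ?_⟩, ?_, ?_⟩
  · rw [← invRev_append, hV, invRev_invRev]
  · intro a ha
    simp only [invRev, List.getLast?_reverse, List.head?_map, Option.mem_def,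
      Option.map_eq_some_iff] at ha
    obtain ⟨b, hb, rfl⟩ := ha
    exact hhead b hb
  · rw [← inv_mk, inv_eq_iff_eq_inv] at heq
    rw [heq, ← inv_mk, mul_inv_rev, zpow_neg]

/-- Representatives of double cosets of two cyclic subgroups spanned by generators. -/
theorem exists_zpow_mul_mk_mul_zpow (i j : α) (g : FreeGroup α) :
    ∃ (k m : ℤ) (U : List (α × Bool)), IsReduced U ∧ (∀ a ∈ U.head?, a.1 ≠ i) ∧
      (∀ a ∈ U.getLast?, a.1 ≠ j) ∧ g = of i ^ k * mk U * of j ^ m := by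
  classical
  obtain ⟨k, U, hU, hhead, heq⟩ := exists_zpow_mul_mk_suffix i g.toWord
  obtain ⟨m, V, hV, hlast, heq'⟩ := exists_mk_prefix_mul_zpow j U
  refine ⟨k, m, V, ?_, ?_, hlast, ?_⟩
  · exact isReduced_toWord.infix (hV.isInfix.trans hU.isInfix)
  · obtain ⟨W, rfl⟩ := hV
    intro a ha
    cases V with
    | nil => simp at ha
    | cons b V => exact hhead a (by simpa using ha)
  · rw [mul_assoc, ← heq', ← heq, mk_toWord]

theorem isCyclicallyReduced_cons_append_cons_invRev {i j : α} (hij : i ≠ j)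
    {U : List (α × Bool)} (hU : IsReduced U) (hhead : ∀ a ∈ U.head?, a.1 ≠ i)
    (hlast : ∀ a ∈ U.getLast?, a.1 ≠ j) :
    IsCyclicallyReduced ((i, true) :: (U ++ (j, true) :: invRev U)) := by
  have hinv : ∀ a ∈ (invRev U).head?, a.1 ≠ j := by
    intro a ha
    simp only [invRev, List.head?_reverse, List.getLast?_map, Option.mem_def,
      Option.map_eq_some_iff] at ha
    obtain ⟨b, hb, rfl⟩ := ha
    exact hlast b hb
  constructor
  · refine List.isChain_cons.2 ⟨?_, List.isChain_append.2
      ⟨hU, List.isChain_cons.2 ⟨?_, hU.invRev⟩, ?_⟩⟩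
    · intro a ha h
      cases U with
      | nil =>
        obtain rfl : (j, true) = a := by simpa using ha
        exact absurd h hij
      | cons b U => exact absurd h.symm (hhead a (by simpa using ha))
    · intro a ha h
      exact absurd h.symm (hinv a ha)
    · intro a ha b hb h
      obtain rfl : (j, true) = b := by simpa using hb
      exact absurd h (hlast a ha)
  · intro a ha b hb h
    obtain rfl : (i, true) = b := by simpa using hb
    cases U with
    | nil =>
      obtain rfl : (j, true) = a := by simpa using ha
      exact absurd h.symm hij
    | cons c U =>
      obtain rfl : (c.1, !c.2) = a := by
        rw [invRev_cons, ← List.cons_append, ← List.cons_append, ← List.append_assoc] at ha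
        exact Option.some.inj (List.getLast?_concat.symm.trans ha)
      exact absurd h (hhead c (by simp))

/-- If replacing the generator `j` by its conjugate by `g` does not change the conjugacy class of
the product of the generators `i` and `j`, then `g` is a product of powers of `i` and `j`. -/
theorem eq_zpow_mul_zpow_of_isConj {i j : α} (hij : i ≠ j) {g : FreeGroup α}
    (h : IsConj (of i * of j) (of i * (g * of j * g⁻¹))) :
    ∃ k m : ℤ, g = of i ^ k * of j ^ m := by
  obtain ⟨k, m, U, hU, hhead, hlast, rfl⟩ := exists_zpow_mul_mk_mul_zpow i j g
  have hconj : IsConj (mk [(i, true), (j, true)])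
      (mk ((i, true) :: (U ++ (j, true) :: invRev U))) := by
    have h₁ : mk [(i, true), (j, true)] = of i * of j := rfl
    have h₂ : mk ((i, true) :: (U ++ (j, true) :: invRev U)) =
        of i * (mk U * of j * (mk U)⁻¹) := by
      simp [of, inv_mk, mul_mk]
    rw [h₁, h₂]
    refine h.trans (isConj_iff.2 ⟨(of i ^ k)⁻¹, ?_⟩)
    group
  have hle := (isCyclicallyReduced_cons_append_cons_invRev hij .nil
    (by simp) (by simp)).length_le_of_isConj
    (isCyclicallyReduced_cons_append_cons_invRev hij hU hhead hlast) hconj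
  obtain rfl : U = [] := by
    rw [← List.length_eq_zero_iff]
    simp at hle
    omega
  exact ⟨k, m, by rw [← one_eq_mk, mul_one]⟩

/-- An endomorphism of a free group preserving the conjugacy classes of the generators and of
the products of two generators is inner. -/
theorem exists_forall_eq_conj (Φ : FreeGroup α →* FreeGroup α)
    (h : ∀ i, IsConj (of i) (Φ (of i))) (h₂ : ∀ i j, IsConj (of i * of j) (Φ (of i * of j))) :
    ∃ c, ∀ g, Φ g = c * g * c⁻¹ := by
  classical
  suffices ∃ c, ∀ i, Φ (of i) = c * of i * c⁻¹ by
    obtain ⟨c, hc⟩ := this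
    refine ⟨c, fun g => ?_⟩
    have : Φ = (MulAut.conj c).toMonoidHom := ext_hom _ _ fun i => by simp [hc]
    simp [this]
  rcases isEmpty_or_nonempty α with _ | ⟨⟨o⟩⟩
  · exact ⟨1, isEmptyElim⟩
  have key {i j : α} (hij : i ≠ j) {c d : FreeGroup α} (hc : Φ (of i) = c * of i * c⁻¹)
      (hd : Φ (of j) = d * of j * d⁻¹) : ∃ k m : ℤ, c⁻¹ * d = of i ^ k * of j ^ m := by
    refine eq_zpow_mul_zpow_of_isConj hij ((h₂ i j).trans (isConj_iff.2 ⟨c⁻¹, ?_⟩))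
    rw [_root_.map_mul, hc, hd]
    group
  obtain ⟨c, hc⟩ := isConj_iff.1 (h o)
  have hpow (i : α) (hi : i ≠ o) :
      ∃ k : ℤ, Φ (of i) = (c * of o ^ k) * of i * (c * of o ^ k)⁻¹ := by
    obtain ⟨d, hd⟩ := isConj_iff.1 (h i)
    obtain ⟨k, m, hkm⟩ := key hi.symm hc.symm hd.symm
    refine ⟨k, ?_⟩
    rw [← hd, eq_mul_of_inv_mul_eq hkm]
    group
  choose k hk using hpow
  have hkk (i j : α) (hi : i ≠ o) (hj : j ≠ o) : k i hi = k j hj := by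
    by_cases hij : i = j
    · subst hij; rfl
    obtain ⟨a, b, hab⟩ := key hij (hk i hi) (hk j hj)
    have := congrArg (lift fun x => if x = o then Multiplicative.ofAdd (1 : ℤ) else 1) hab
    simp [hi, hj, ← ofAdd_zsmul, ← ofAdd_neg, ← ofAdd_add] at this
    omega
  by_cases hex : ∃ i, i ≠ o
  · obtain ⟨i, hi⟩ := hex
    refine ⟨c * of o ^ k i hi, fun j => ?_⟩
    by_cases hj : j = o
    · subst hj
      rw [← hc]
      group
    · rw [hkk i j hi hj]
      exact hk j hj
  · push Not at hex
    exact ⟨c, fun i => by rw [hex i, hc]⟩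

end FreeGroup

/-- **(Grossman; property A for free groups of finite rank.)** Every automorphism of a
free group of finite rank sending each element to a conjugate of itself is an inner
automorphism. -/
theorem inner_of_forall_isConj (n : ℕ)
    (Φ : FreeGroup (Fin n) ≃* FreeGroup (Fin n))
    (h : ∀ g : FreeGroup (Fin n), IsConj g (Φ g)) :
    ∃ c : FreeGroup (Fin n), ∀ g : FreeGroup (Fin n), Φ g = c * g * c⁻¹ :=
  FreeGroup.exists_forall_eq_conj Φ.toMonoidHom (fun _ => h _) (fun _ _ => h _)
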